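/- arXiv:1004.4208 — 2 statements merged into one kernel-verified Lean document; each statement's English description precedes it below -/
import Mathlib

section
/- Let q ∈ k[T] be a monic reciprocal polynomial of even degree d over a field k of characteristic not 2. Then there exists a non-degenerate skew-symmetric bilinear form of determinant 1 on a d-dimensional k-vector space admitting an isometry γ with characteristic polynomial q. -/
open Polynomial

section Palindromic

variable {k : Type*} [Field k]

theorem reflect_X_sq_add_one_pow (n : ℕ) :
    reflect (2 * n) ((X ^ 2 + 1 : k[X]) ^ n) = (X ^ 2 + 1) ^ n := by
  have hbase : reflect 2 (X ^ 2 + 1 : k[X]) = X ^ 2 + 1 := by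
    rw [reflect_add, reflect_monomial, ← C_1, reflect_C, revAt_le le_rfl]
    simp [add_comm]
  have hdeg : (X ^ 2 + 1 : k[X]).natDegree ≤ 2 := by compute_degree
  induction n with
  | zero => rw [pow_zero, ← C_1, reflect_C]; simp
  | succ n ih =>
    rw [pow_succ, mul_add, mul_one, reflect_mul _ _ _ hdeg, ih, hbase]
    exact (natDegree_pow_le_of_le n hdeg).trans (by omega)

/-- A polynomial which is palindromic of length `2 * m` is `X ^ m` times a polynomial of degree at
most `m` in `X + X⁻¹`. -/
theorem exists_eval₂_add_inv_of_reflect_eq {K : Type*} [Field K] (f : k →+* K) {t : K}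
    (ht : t ≠ 0) (m : ℕ) (q : k[X]) (hdeg : q.natDegree ≤ 2 * m) (hq : reflect (2 * m) q = q) :
    ∃ h : k[X], h.natDegree ≤ m ∧ h.coeff m = q.coeff (2 * m) ∧
      eval₂ f t q = t ^ m * eval₂ f (t + t⁻¹) h := by
  induction m generalizing q with
  | zero =>
    rw [eq_C_of_natDegree_le_zero hdeg]
    exact ⟨C (q.coeff 0), by simp⟩
  | succ m ih =>
    set p : k[X] := q - C (q.coeff 0) * (X ^ 2 + 1) ^ (m + 1) with hp
    have hp_reflect : reflect (2 * (m + 1)) p = p := by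
      rw [hp, reflect_sub, reflect_C_mul, reflect_X_sq_add_one_pow, hq]
    have hp_zero : p.coeff 0 = 0 := by simp [hp, coeff_zero_eq_eval_zero]
    have hp_deg : p.natDegree ≤ 2 * (m + 1) := by
      refine (natDegree_sub_le_of_le hdeg ((natDegree_C_mul_le _ _).trans ?_)).trans (max_self _).le
      have hbase : (X ^ 2 + 1 : k[X]).natDegree ≤ 2 := by compute_degree
      exact (natDegree_pow_le_of_le (m + 1) hbase).trans (by omega)
    have hcoeff (i : ℕ) (hi : i ≤ 2 * (m + 1)) : p.coeff (2 * (m + 1) - i) = p.coeff i := by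
      conv_rhs => rw [← hp_reflect, coeff_reflect, revAt_le hi]
    have hq_top : q.coeff (2 * (m + 1)) = q.coeff 0 := by
      conv_rhs => rw [← hq, coeff_reflect, revAt_le (Nat.zero_le _), Nat.sub_zero]
    have hp_eq : p = p.divX * X := by
      conv_lhs => rw [← divX_mul_X_add p, hp_zero, C_0, add_zero]
    have hdiv_deg : p.divX.natDegree ≤ 2 * m := by
      rw [natDegree_le_iff_coeff_eq_zero]
      intro N hN
      rw [coeff_divX]
      obtain hN | hN : N + 1 = 2 * (m + 1) ∨ 2 * (m + 1) < N + 1 := by omega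
      · have := hcoeff 0 (Nat.zero_le _)
        rwa [Nat.sub_zero, hp_zero, ← hN] at this
      · exact coeff_eq_zero_of_natDegree_lt (hp_deg.trans_lt hN)
    have hdiv_reflect : reflect (2 * m) p.divX = p.divX := by
      ext i
      rw [coeff_reflect]
      rcases le_or_gt i (2 * m) with hi | hi
      · rw [revAt_le hi, coeff_divX, coeff_divX, ← hcoeff (i + 1) (by omega)]
        congr 1
        omega
      · rw [revAt_eq_self_of_lt hi]
    obtain ⟨h, hh, -, hh_eval⟩ := ih p.divX hdiv_deg hdiv_reflect
    refine ⟨h + C (q.coeff 0) * X ^ (m + 1), ?_, ?_, ?_⟩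
    · exact natDegree_add_le_of_degree_le (hh.trans (by omega)) (natDegree_C_mul_X_pow_le _ _)
    · rw [coeff_add, coeff_eq_zero_of_natDegree_lt (by omega), hq_top]
      simp
    · have hq_eq : q = p.divX * X + C (q.coeff 0) * (X ^ 2 + 1) ^ (m + 1) := by
        rw [← hp_eq, hp]; ring
      have hsq : t ^ 2 + 1 = t * (t + t⁻¹) := by field_simp
      conv_lhs => rw [hq_eq]
      simp only [eval₂_add, eval₂_mul, eval₂_X, eval₂_C, eval₂_pow, eval₂_one, hh_eval, hsq,
        mul_pow]
      ring

end Palindromic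

section Hankel

open Matrix

variable {k : Type*} [Field k]

/-- Multiplication by the generator of a power basis is self-adjoint with respect to the symmetric
bilinear form `(a, b) ↦ (top coefficient of a * b)`, whose determinant is a sign. -/
theorem PowerBasis.exists_symm_form {A : Type*} [CommRing A] [Algebra k A] (pb : PowerBasis k A)
    (hdim : 0 < pb.dim) :
    ∃ H : Matrix (Fin pb.dim) (Fin pb.dim) k, Hᵀ = H ∧ H.det ^ 2 = 1 ∧
      (H * Algebra.leftMulMatrix pb.basis pb.gen)ᵀ =
        H * Algebra.leftMulMatrix pb.basis pb.gen := by
  let τ : A →ₗ[k] k := pb.basis.coord ⟨pb.dim - 1, by omega⟩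
  have hτ (l : ℕ) (hl : l < pb.dim) : τ (pb.gen ^ l) = if l = pb.dim - 1 then 1 else 0 := by
    have : pb.gen ^ l = pb.basis ⟨l, hl⟩ := by simp
    rw [this, Module.Basis.coord_apply, Module.Basis.repr_self, Finsupp.single_apply]
    simp [Fin.ext_iff]
  let H : Matrix (Fin pb.dim) (Fin pb.dim) k := of fun i j => τ (pb.basis i * pb.basis j)
  have hmul (i j) : (H * Algebra.leftMulMatrix pb.basis pb.gen) i j =
      τ (pb.basis i * (pb.gen * pb.basis j)) := by
    conv_rhs => rw [← pb.basis.sum_repr (pb.gen * pb.basis j)]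
    simp [mul_apply, H, Algebra.leftMulMatrix_eq_repr_mul, Finset.mul_sum, mul_comm]
  refine ⟨H, ?_, ?_, ?_⟩
  · ext i j
    simp [H, mul_comm]
  · have hdet : (H.submatrix id Fin.revPerm).det = 1 := by
      rw [det_of_isLowerTriangular]
      · refine Finset.prod_eq_one fun i _ => ?_
        have := i.2
        simp only [submatrix_apply, id, Fin.revPerm_apply, H, of_apply, PowerBasis.coe_basis,
          ← pow_add, Fin.val_rev]
        rw [hτ _ (by omega), if_pos (by omega)]
      · intro i j hij
        have hij : i < j := by simpa using hij
        have := j.2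
        simp only [submatrix_apply, id, Fin.revPerm_apply, H, of_apply, PowerBasis.coe_basis,
          ← pow_add, Fin.val_rev]
        rw [hτ _ (by omega), if_neg (by omega)]
    rw [det_permute'] at hdet
    obtain hs | hs := Int.units_eq_one_or (Equiv.Perm.sign (Fin.revPerm (n := pb.dim)))
    · simp only [hs, Units.val_one, Int.cast_one, one_mul] at hdet
      rw [hdet, one_pow]
    · simp only [hs, Units.val_neg, Units.val_one, Int.cast_neg, Int.cast_one, neg_mul,
        one_mul] at hdet
      rw [← neg_sq, hdet, one_pow]
  · ext i j
    rw [transpose_apply, hmul, hmul]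
    congr 1
    ring

end Hankel

section Block

open Matrix

variable {n : Type*} [Fintype n] [DecidableEq n]

theorem Matrix.eval₂_charpoly_fromBlocks_zero_neg_one_one {k K : Type*} [Field k] [Field K]
    (f : k →+* K) {t : K} (ht : t ≠ 0) (S : Matrix n n k) :
    eval₂ f t (fromBlocks (0 : Matrix n n k) (-1) 1 S).charpoly =
      t ^ Fintype.card n * eval₂ f (t + t⁻¹) S.charpoly := by
  let _ : Invertible (scalar n t) := ⟨scalar n t⁻¹, by simp [ht], by simp [ht]⟩
  have hinv : ⅟(scalar n t) = scalar n t⁻¹ := rfl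
  have hblock : scalar (n ⊕ n) t - (fromBlocks (0 : Matrix n n k) (-1) 1 S).map f =
      fromBlocks (scalar n t) 1 (-1) (scalar n t - S.map f) := by
    ext (i | i) (j | j) <;> simp [diagonal_apply, one_apply, apply_ite f]
  rw [← eval_map, ← eval_map, ← charpoly_map, ← charpoly_map, eval_charpoly, eval_charpoly, hblock,
    det_fromBlocks₁₁, hinv]
  congr 1
  · simp
  · congr 1
    rw [map_add, neg_mul, mul_one, one_mul, sub_neg_eq_add, sub_add_eq_add_sub]

theorem Matrix.transpose_mul_fromBlocks_mul {k : Type*} [CommRing k] {H S : Matrix n n k}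
    (hH : Hᵀ = H) (hS : (H * S)ᵀ = H * S) :
    (fromBlocks 0 (-1) 1 S)ᵀ * fromBlocks 0 H (-H) 0 * fromBlocks 0 (-1) 1 S =
      fromBlocks 0 H (-H) 0 := by
  rw [transpose_mul, hH] at hS
  simp [fromBlocks_transpose, fromBlocks_multiply, hS]

theorem Matrix.det_fromBlocks_zero_neg {k : Type*} [CommRing k] (H : Matrix n n k) :
    (fromBlocks 0 H (-H) 0).det = H.det ^ 2 := by
  have hfac : fromBlocks 0 H (-H) 0 =
      fromBlocks 1 1 0 1 * fromBlocks 1 0 (-1) 1 * fromBlocks 1 1 0 1 * fromBlocks H 0 0 H := by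
    simp [fromBlocks_multiply]
  rw [hfac]
  simp [sq]

end Block

/-- Every monic reciprocal polynomial of even degree `d` over a field of
characteristic not 2 is the characteristic polynomial of an isometry of a
non-degenerate skew-symmetric bilinear form of determinant 1 on a
`d`-dimensional space. -/
theorem exists_symplectic_isometry_with_charpoly {k : Type*} [Field k]
    (hchar : (2 : k) ≠ 0) (q : k[X]) (hq : q.Monic)
    (hrec : q.reverse = q) (hd : 1 ≤ q.natDegree) (heven : Even q.natDegree) :
    ∃ B M : Matrix (Fin q.natDegree) (Fin q.natDegree) k,
      B.transpose = -B ∧ B.det = 1 ∧ M.transpose * B * M = B ∧ M.charpoly = q := by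
  obtain ⟨m, hm⟩ := heven
  rw [← two_mul] at hm
  let f : k →+* RatFunc k := algebraMap k (RatFunc k)
  have heval (p : k[X]) : eval₂ f RatFunc.X p = algebraMap k[X] (RatFunc k) p := by
    rw [← aeval_def, ← RatFunc.algebraMap_X, aeval_algebraMap_apply, aeval_X_left_apply]
  obtain ⟨h, hh_deg, hh_coeff, hh_eval⟩ := exists_eval₂_add_inv_of_reflect_eq f
    (RatFunc.X_ne_zero (K := k)) m q hm.le (by rw [← hm]; exact hrec)
  rw [← hm, hq.coeff_natDegree] at hh_coeff
  have hh : h.Monic := monic_of_natDegree_le_of_coeff_eq_one m hh_deg hh_coeff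
  have hh_natDegree : h.natDegree = m :=
    natDegree_eq_of_le_of_coeff_ne_zero hh_deg (by simp [hh_coeff])
  let pb := AdjoinRoot.powerBasis hh.ne_zero
  have hdim : pb.dim = m := hh_natDegree
  obtain ⟨H, hH, hH_det, hHS⟩ := pb.exists_symm_form (by omega)
  have hS := charpoly_leftMulMatrix pb
  rw [AdjoinRoot.minpoly_powerBasis_gen_of_monic hh] at hS
  generalize Algebra.leftMulMatrix pb.basis pb.gen = S at hHS hS
  let e : Fin pb.dim ⊕ Fin pb.dim ≃ Fin q.natDegree :=
    Fintype.equivOfCardEq (by simp [hdim, hm, two_mul])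
  refine ⟨Matrix.reindex e e (.fromBlocks 0 H (-H) 0),
    Matrix.reindex e e (.fromBlocks 0 (-1) 1 S), ?_, ?_, ?_, ?_⟩
  · rw [Matrix.transpose_reindex, Matrix.fromBlocks_transpose]
    ext i j
    rcases hi : e.symm i with a | a <;> rcases hj : e.symm j with b | b <;> simp [hi, hj, hH]
  · rw [Matrix.det_reindex_self, Matrix.det_fromBlocks_zero_neg, hH_det]
  · rw [Matrix.transpose_reindex]
    simp only [Matrix.reindex_apply, Matrix.submatrix_mul_equiv]
    rw [Matrix.transpose_mul_fromBlocks_mul hH hHS]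
  · rw [Matrix.charpoly_reindex]
    apply IsFractionRing.injective k[X] (RatFunc k)
    rw [← heval, ← heval, hh_eval,
      Matrix.eval₂_charpoly_fromBlocks_zero_neg_one_one f RatFunc.X_ne_zero, hS, Fintype.card_fin,
      hdim]
end

section
/- Let q ∈ k[T] be a monic reciprocal polynomial of degree d ≥ 1 over a field k of characteristic not 2. Then there exists a non-degenerate symmetric bilinear form on a d-dimensional k-vector space admitting an isometry γ with characteristic polynomial q. -/
open Polynomial

/-- `q` is the characteristic polynomial of an isometry of a non-degenerate symmetric bilinear
form, in matrix terms and with an arbitrary finite index type. -/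
def IsOrthogonalCharpoly {k : Type*} [Field k] (q : k[X]) : Prop :=
  ∃ (ι : Type) (_ : Fintype ι) (_ : DecidableEq ι) (B M : Matrix ι ι k),
    B.transpose = B ∧ B.det ≠ 0 ∧ M.transpose * B * M = B ∧ M.charpoly = q

namespace IsOrthogonalCharpoly

variable {k : Type*} [Field k]

theorem one : IsOrthogonalCharpoly (1 : k[X]) :=
  ⟨Empty, inferInstance, inferInstance, 1, 1, by simp⟩

theorem mul {p q : k[X]} (hp : IsOrthogonalCharpoly p) (hq : IsOrthogonalCharpoly q) :
    IsOrthogonalCharpoly (p * q) := by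
  obtain ⟨ι, _, _, B, M, hB, hBdet, hM, rfl⟩ := hp
  obtain ⟨κ, _, _, D, N, hD, hDdet, hN, rfl⟩ := hq
  refine ⟨ι ⊕ κ, inferInstance, inferInstance, Matrix.fromBlocks B 0 0 D,
    Matrix.fromBlocks M 0 0 N, ?_, ?_, ?_, ?_⟩
  · simp [Matrix.fromBlocks_transpose, hB, hD]
  · simp [hBdet, hDdet]
  · simp [Matrix.fromBlocks_transpose, Matrix.fromBlocks_multiply, hM, hN]
  · simp

theorem X_sub_C {ε : k} (hε : ε * ε = 1) : IsOrthogonalCharpoly (X - C ε) := by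
  refine ⟨Unit, inferInstance, inferInstance, 1, Matrix.diagonal fun _ => ε, by simp, by simp,
    ?_, by simp [Matrix.charpoly_diagonal]⟩
  simp [hε]

theorem exists_fin {q : k[X]} (hq : IsOrthogonalCharpoly q) :
    ∃ B M : Matrix (Fin q.natDegree) (Fin q.natDegree) k,
      B.transpose = B ∧ B.det ≠ 0 ∧ M.transpose * B * M = B ∧ M.charpoly = q := by
  obtain ⟨ι, _, _, B, M, hB, hBdet, hM, hMq⟩ := hq
  have e : ι ≃ Fin q.natDegree :=
    Fintype.equivFinOfCardEq (by rw [← hMq, Matrix.charpoly_natDegree_eq_dim])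
  refine ⟨Matrix.reindex e e B, Matrix.reindex e e M, ?_, ?_, ?_, ?_⟩
  · rw [Matrix.transpose_reindex, hB]
  · rwa [Matrix.det_reindex_self]
  · simp [Matrix.transpose_submatrix, Matrix.submatrix_mul_equiv, hM]
  · rw [Matrix.charpoly_reindex, hMq]

end IsOrthogonalCharpoly

section SelfAdjoint

variable {k : Type*} [Field k]

/-- The multiplication by the root in `k[T]/(h)` is self-adjoint for the form
`(x, y) ↦ ℓ (x * y)`, where `ℓ` reads off the top coefficient. -/
theorem exists_selfAdjoint_with_charpoly {h : k[X]} (hh : h.Monic) (hd : 0 < h.natDegree) :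
    ∃ S A : Matrix (Fin h.natDegree) (Fin h.natDegree) k,
      S.transpose = S ∧ S.det ≠ 0 ∧ A.transpose * S = S * A ∧ A.charpoly = h := by
  have : Nontrivial (AdjoinRoot h) :=
    AdjoinRoot.nontrivial h (by rw [degree_eq_natDegree hh.ne_zero]; exact_mod_cast hd.ne')
  let pb := AdjoinRoot.powerBasis' hh
  let b : Module.Basis (Fin h.natDegree) k (AdjoinRoot h) := pb.basis
  let r := AdjoinRoot.root h
  have hb : ∀ i, b i = r ^ (i : ℕ) := fun i => pb.basis_eq_pow i
  let l : AdjoinRoot h →ₗ[k] k := b.coord ⟨h.natDegree - 1, by omega⟩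
  let S : Matrix (Fin h.natDegree) (Fin h.natDegree) k := Matrix.of fun i j => l (b i * b j)
  let A := Algebra.leftMulMatrix b r
  have hA : ∀ j, ∑ i, A i j • b i = r * b j := fun j => by
    simp [A, Algebra.leftMulMatrix_eq_repr_mul, b.sum_repr]
  have hSA : ∀ i j, (S * A) i j = l (b i * (r * b j)) := fun i j => by
    rw [← hA, Finset.mul_sum, map_sum, Matrix.mul_apply]
    exact Finset.sum_congr rfl fun m _ => by simp [S, mul_comm]
  have hS : S.transpose = S := by ext i j; simp [S, mul_comm]
  refine ⟨S, A, hS, ?_, ?_, ?_⟩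
  · have hl : ∀ i j : Fin h.natDegree, i ≤ j →
        l (b i * b (Fin.rev j)) = if i = j then 1 else 0 := by
      intro i j hij
      have hij' : (i : ℕ) ≤ j := hij
      have hm : (i : ℕ) + Fin.rev j < h.natDegree := by rw [Fin.val_rev]; omega
      have : b i * b (Fin.rev j) = b ⟨i + Fin.rev j, hm⟩ := by simp only [hb, pow_add]
      rw [this, Module.Basis.coord_apply, Module.Basis.repr_self, Finsupp.single_apply]
      congr 1
      simp only [Fin.ext_iff, Fin.val_rev, eq_iff_iff]
      omega
    have htri : (S.submatrix id Fin.revPerm).det = 1 := by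
      rw [Matrix.det_of_isLowerTriangular]
      · exact Finset.prod_eq_one fun i _ => by simpa [S] using hl i i le_rfl
      · intro i j hij
        have hij' : i < j := hij
        simpa [S, hij'.ne] using hl i j hij'.le
    intro h0
    rw [Matrix.det_permute', h0, mul_zero] at htri
    exact zero_ne_one htri
  · rw [← Matrix.transpose_inj, Matrix.transpose_mul, Matrix.transpose_transpose, hS]
    ext i j
    rw [Matrix.transpose_apply, hSA, hSA]
    congr 1
    ring
  · have h1 : A.charpoly = minpoly k pb.gen := charpoly_leftMulMatrix pb
    rw [h1]
    change minpoly k (AdjoinRoot.root h) = h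
    rw [AdjoinRoot.minpoly_root hh.ne_zero, hh.leadingCoeff]
    simp

end SelfAdjoint

section Companion

variable {n : Type*} [Fintype n] [DecidableEq n]

theorem eval_charpoly_fromBlocks_zero_neg_one {K : Type*} [Field K] (A : Matrix n n K) {t : K}
    (ht : t ≠ 0) :
    (Matrix.fromBlocks (0 : Matrix n n K) (-1) 1 A).charpoly.eval t =
      t ^ Fintype.card n * A.charpoly.eval (t + t⁻¹) := by
  have hblocks : Matrix.scalar (n ⊕ n) t - Matrix.fromBlocks 0 (-1) 1 A =
      Matrix.fromBlocks (Matrix.scalar n t) 1 (-1) (Matrix.scalar n t - A) := by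
    rw [sub_eq_iff_eq_add, Matrix.fromBlocks_add]
    simp
  let _ : Invertible (Matrix.scalar n t) :=
    ⟨Matrix.scalar n t⁻¹, by rw [← map_mul, inv_mul_cancel₀ ht, map_one],
      by rw [← map_mul, mul_inv_cancel₀ ht, map_one]⟩
  have hinv : ⅟(Matrix.scalar n t) = Matrix.scalar n t⁻¹ := rfl
  rw [Matrix.eval_charpoly, Matrix.eval_charpoly, hblocks, Matrix.det_fromBlocks₁₁, hinv, map_add]
  congr 1
  · simp
  · congr 1
    rw [Matrix.mul_one, neg_one_mul]
    abel

theorem charpoly_fromBlocks_zero_neg_one {k : Type*} [Field k] (A : Matrix n n k) {q : k[X]}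
    (hq : aeval (algebraMap k[X] (FractionRing k[X]) X) q =
      algebraMap k[X] (FractionRing k[X]) X ^ Fintype.card n *
        aeval (algebraMap k[X] (FractionRing k[X]) X +
          (algebraMap k[X] (FractionRing k[X]) X)⁻¹) A.charpoly) :
    (Matrix.fromBlocks (0 : Matrix n n k) (-1) 1 A).charpoly = q := by
  set K := FractionRing k[X]
  have hinj := IsFractionRing.injective k[X] K
  have ht : algebraMap k[X] K X ≠ 0 := by simp
  have haeval : ∀ p : k[X], aeval (algebraMap k[X] K X) p = algebraMap k[X] K p := fun p => by
    rw [aeval_algebraMap_apply, aeval_X_left_apply]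
  apply hinj
  rw [← haeval q, hq, ← haeval (Matrix.charpoly _), aeval_def, aeval_def, ← eval_map,
    ← eval_map, ← Matrix.charpoly_map, ← Matrix.charpoly_map,
    ← eval_charpoly_fromBlocks_zero_neg_one _ ht, Matrix.fromBlocks_map]
  congr 3
  · simp
  · ext i j
    by_cases h : i = j <;> simp [h]
  · simp

theorem det_fromBlocks_two {R : Type*} [CommRing R] (A : Matrix n n R) :
    (Matrix.fromBlocks 2 A A 2).det = (2 + A).det * (2 - A).det := by
  have h : Matrix.fromBlocks 1 1 0 1 * Matrix.fromBlocks 2 A A 2 * Matrix.fromBlocks 1 (-1) 0 1 =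
      Matrix.fromBlocks (2 + A) 0 A (2 - A) := by
    rw [Matrix.fromBlocks_multiply, Matrix.fromBlocks_multiply]
    simp [add_comm, sub_eq_add_neg]
    abel
  simpa using congrArg Matrix.det h

/-- If `T ^ n * h (T + T⁻¹) = q` with `h (±2) ≠ 0`, then `q` is the characteristic polynomial of the
isometry `[[0, -1], [1, A]]` of the form `[[2S, SA], [SA, 2S]]`, where `A` is self-adjoint for `S`
with characteristic polynomial `h`. -/
theorem isOrthogonalCharpoly_of_trace_polynomial {k : Type*} [Field k] {h q : k[X]}
    (hh : h.Monic) (hd : 0 < h.natDegree) (h2 : h.eval 2 ≠ 0) (h2' : h.eval (-2) ≠ 0)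
    (hq : aeval (algebraMap k[X] (FractionRing k[X]) X) q =
      algebraMap k[X] (FractionRing k[X]) X ^ h.natDegree *
        aeval (algebraMap k[X] (FractionRing k[X]) X +
          (algebraMap k[X] (FractionRing k[X]) X)⁻¹) h) :
    IsOrthogonalCharpoly q := by
  obtain ⟨S, A, hS, hSdet, hSA, hA⟩ := exists_selfAdjoint_with_charpoly hh hd
  refine ⟨_, inferInstance, inferInstance,
    Matrix.fromBlocks S 0 0 S * Matrix.fromBlocks 2 A A 2, Matrix.fromBlocks 0 (-1) 1 A,
    ?_, ?_, ?_, ?_⟩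
  · simp only [Matrix.transpose_mul, Matrix.fromBlocks_transpose, Matrix.fromBlocks_multiply, hS,
      hSA, Matrix.zero_mul, add_zero, zero_add,
      Matrix.transpose_ofNat]
    simp [mul_two, two_mul]
  · rw [Matrix.det_mul, det_fromBlocks_two, Matrix.det_fromBlocks_zero₁₂]
    refine mul_ne_zero (mul_ne_zero hSdet hSdet) (mul_ne_zero ?_ ?_)
    · rw [← hA, Matrix.eval_charpoly] at h2'
      have : 2 + A = -(Matrix.scalar _ (-2 : k) - A) := by
        rw [map_neg, map_ofNat]; abel
      rw [this, Matrix.det_neg]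
      exact mul_ne_zero (pow_ne_zero _ (neg_ne_zero.2 one_ne_zero)) h2'
    · rwa [← hA, Matrix.eval_charpoly, map_ofNat] at h2
  · have hAA : A.transpose * (S * A) = S * A * A := by rw [← Matrix.mul_assoc, hSA]
    simp only [Matrix.fromBlocks_transpose, Matrix.fromBlocks_multiply]
    simp [Matrix.mul_assoc, mul_add, add_mul, mul_two, hSA, hAA]
  · refine charpoly_fromBlocks_zero_neg_one A ?_
    rw [hA, Fintype.card_fin, hq]

end Companion

section Reciprocal

variable {k : Type*} [Field k]

theorem reverse_X_sq_add_one : reverse (X ^ 2 + 1 : k[X]) = X ^ 2 + 1 := by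
  rw [← C_1, reverse_add_C]
  simp [reverse, reflect_monomial, add_comm]

/-- A reciprocal polynomial of formal degree `2 * n` has the form `T ^ n * h (T + T⁻¹)`. -/
theorem exists_trace_polynomial (n : ℕ) (q : k[X]) (hd : q.natDegree ≤ 2 * n)
    (hq : reflect (2 * n) q = q) :
    ∃ h : k[X], h.natDegree ≤ n ∧ h.coeff n = q.coeff 0 ∧
      ∀ (K : Type _) [Field K] [Algebra k K] (t : K), t ≠ 0 →
        aeval t q = t ^ n * aeval (t + t⁻¹) h := by
  induction n generalizing q with
  | zero =>
    refine ⟨q, by simpa using hd, rfl, fun K _ _ t _ => ?_⟩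
    rw [eq_C_of_natDegree_le_zero (by simpa using hd : q.natDegree ≤ 0)]
    simp
  | succ n ih =>
    let r := q - C (q.coeff 0) * (X ^ 2 + 1) ^ (n + 1)
    have hr : reflect (2 * (n + 1)) r = r := by
      rw [reflect_sub, reflect_C_mul, hq, reflect_X_sq_add_one_pow]
    have hrd : r.natDegree ≤ 2 * (n + 1) := by
      refine (natDegree_sub_le_of_le hd ((natDegree_C_mul_le _ _).trans ?_)).trans (max_self _).le
      compute_degree
      omega
    have hr0 : r.coeff 0 = 0 := by simp [r, coeff_zero_eq_eval_zero]
    have hrc : ∀ i ≤ 2 * (n + 1), r.coeff (2 * (n + 1) - i) = r.coeff i := fun i hi => by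
      rw [← revAt_le hi, ← coeff_reflect, hr]
    obtain ⟨p, hp⟩ := X_dvd_iff.2 hr0
    have hpc : ∀ i, p.coeff i = r.coeff (i + 1) := fun i => by rw [hp, coeff_X_mul]
    have hpd : p.natDegree ≤ 2 * n := by
      rw [natDegree_le_iff_coeff_eq_zero]
      intro i hi
      rw [hpc]
      rcases eq_or_lt_of_le (show 2 * n + 1 ≤ i from hi) with rfl | hi'
      · have := hrc 0 (by omega)
        rwa [hr0] at this
      · exact coeff_eq_zero_of_natDegree_lt (by omega)
    have hpr : reflect (2 * n) p = p := by
      ext i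
      rw [coeff_reflect]
      rcases le_or_gt i (2 * n) with hi | hi
      · rw [revAt_le hi, hpc, hpc, ← hrc (i + 1) (by omega)]
        congr 1
        omega
      · rw [revAt_eq_self_of_lt hi]
    obtain ⟨h, hhd, -, hh⟩ := ih p hpd hpr
    refine ⟨h + C (q.coeff 0) * X ^ (n + 1), ?_, ?_, fun K _ _ t ht => ?_⟩
    · exact natDegree_add_le_of_degree_le (hhd.trans n.le_succ) (natDegree_C_mul_X_pow_le _ _)
    · rw [coeff_add, coeff_eq_zero_of_natDegree_lt (Nat.lt_succ_of_le hhd)]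
      simp
    · have hqr : q = X * p + C (q.coeff 0) * (X ^ 2 + 1) ^ (n + 1) := by
        rw [← hp]; simp [r]
      have ht2 : t ^ 2 + 1 = t * (t + t⁻¹) := by field_simp
      conv_lhs => rw [hqr]
      simp only [map_add, map_mul, map_pow, aeval_X, aeval_C, map_one, hh K t ht, ht2, mul_pow]
      ring

theorem eval_neg_one_of_reverse_eq {q : k[X]} (hrec : q.reverse = q) :
    q.eval (-1) * (-1) ^ q.natDegree = q.eval (-1) := by
  let _ : Invertible (-1 : k) := ⟨-1, by simp, by simp⟩
  simpa [hrec, show ⅟(-1 : k) = -1 from rfl] using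
    eval₂_reverse_mul_pow (RingHom.id k) (-1 : k) q

theorem eval_one_reverse (q : k[X]) : q.reverse.eval 1 = q.eval 1 := by
  let _ : Invertible (1 : k) := invertibleOne
  simpa using eval₂_reverse_mul_pow (RingHom.id k) (1 : k) q

theorem reverse_X_add_one : reverse (X - C (-1) : k[X]) = X - C (-1) := by
  rw [sub_eq_add_neg, ← C_neg, reverse_add_C]
  simp [reverse, add_comm]

theorem reverse_X_sub_one : reverse (X - C 1 : k[X]) = -(X - C 1) := by
  rw [sub_eq_add_neg, ← C_neg, reverse_add_C]
  simp [reverse]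

theorem isOrthogonalCharpoly_of_reverse_eq (hchar : (2 : k) ≠ 0) (q : k[X]) (hq : q.Monic)
    (hrec : q.reverse = q) : IsOrthogonalCharpoly q := by
  induction hn : q.natDegree using Nat.strong_induction_on generalizing q with
  | _ d ih =>
  subst hn
  by_cases hneg : q.eval (-1) = 0
  · obtain ⟨p, rfl⟩ := dvd_iff_isRoot.2 hneg
    have hp : p.Monic := (monic_X_sub_C (-1)).of_mul_monic_left hq
    rw [reverse_mul_of_domain, reverse_X_add_one] at hrec
    refine (IsOrthogonalCharpoly.X_sub_C (by simp)).mul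
      (ih _ ?_ p hp (mul_left_cancel₀ (X_sub_C_ne_zero _) hrec) rfl)
    rw [natDegree_mul (X_sub_C_ne_zero _) hp.ne_zero, natDegree_X_sub_C]
    omega
  by_cases hone : q.eval 1 = 0
  · obtain ⟨p, rfl⟩ := dvd_iff_isRoot.2 hone
    have hp : p.Monic := (monic_X_sub_C 1).of_mul_monic_left hq
    have hprec : p.reverse = -p := by
      rw [reverse_mul_of_domain, reverse_X_sub_one, neg_mul, ← mul_neg] at hrec
      exact neg_eq_iff_eq_neg.1 (mul_left_cancel₀ (X_sub_C_ne_zero _) hrec)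
    have hp1 : p.eval 1 = 0 := by
      have h1 := eval_one_reverse p
      rw [hprec, eval_neg] at h1
      have h2 : 2 * p.eval 1 = 0 := by linear_combination -h1
      exact (mul_eq_zero.1 h2).resolve_left hchar
    obtain ⟨s, rfl⟩ := dvd_iff_isRoot.2 hp1
    have hs : s.Monic := (monic_X_sub_C 1).of_mul_monic_left hp
    rw [reverse_mul_of_domain, reverse_X_sub_one, neg_mul, neg_inj] at hprec
    have hX := IsOrthogonalCharpoly.X_sub_C (k := k) (ε := 1) (by simp)
    refine hX.mul (hX.mul (ih _ ?_ s hs (mul_left_cancel₀ (X_sub_C_ne_zero _) hprec) rfl))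
    rw [natDegree_mul (X_sub_C_ne_zero _) hp.ne_zero,
      natDegree_mul (X_sub_C_ne_zero _) hs.ne_zero, natDegree_X_sub_C]
    omega
  have heven : Even q.natDegree := by
    by_contra hodd
    have h1 := eval_neg_one_of_reverse_eq hrec
    rw [(Nat.not_even_iff_odd.1 hodd).neg_one_pow] at h1
    have h2 : 2 * q.eval (-1) = 0 := by linear_combination -h1
    exact hneg ((mul_eq_zero.1 h2).resolve_left hchar)
  obtain ⟨n, hn⟩ := heven.two_dvd
  obtain ⟨h, hhd, hhn, hh⟩ := exists_trace_polynomial n q hn.le (by rw [← hn]; exact hrec)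
  have hhn' : h.coeff n = 1 := by
    rw [hhn, ← hrec, coeff_zero_reverse, hq.leadingCoeff]
  have hhm : h.Monic := monic_of_natDegree_le_of_coeff_eq_one n hhd hhn'
  have hhdeg : h.natDegree = n :=
    natDegree_eq_of_le_of_coeff_ne_zero hhd (by rw [hhn']; exact one_ne_zero)
  rcases Nat.eq_zero_or_pos n with rfl | hpos
  · rw [hq.natDegree_eq_zero.1 hn]
    exact IsOrthogonalCharpoly.one
  have h1 := hh k 1 one_ne_zero
  have h2 := hh k (-1) (neg_ne_zero.2 one_ne_zero)
  simp only [coe_aeval_eq_eval] at h1 h2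
  refine isOrthogonalCharpoly_of_trace_polynomial hhm (by omega) ?_ ?_ ?_
  · intro h0
    refine hone ?_
    rw [h1, inv_one, one_add_one_eq_two, h0, mul_zero]
  · intro h0
    refine hneg ?_
    rw [h2, inv_neg, inv_one, show (-1 + -1 : k) = -2 by norm_num, h0, mul_zero]
  · rw [hhdeg]
    exact hh _ _ (by simp)

end Reciprocal

/-- Every monic reciprocal polynomial of degree `d ≥ 1` over a field of
characteristic not 2 is the characteristic polynomial of an isometry of a
non-degenerate symmetric bilinear form on a `d`-dimensional space. -/
theorem exists_orthogonal_isometry_with_charpoly {k : Type*} [Field k]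
    (hchar : (2 : k) ≠ 0) (q : k[X]) (hq : q.Monic)
    (hrec : q.reverse = q) (hd : 1 ≤ q.natDegree) :
    ∃ B M : Matrix (Fin q.natDegree) (Fin q.natDegree) k,
      B.transpose = B ∧ B.det ≠ 0 ∧ M.transpose * B * M = B ∧ M.charpoly = q :=
  (isOrthogonalCharpoly_of_reverse_eq hchar q hq hrec).exists_fin
end
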